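/- Every polynomial f ∈ K[X] that is invariant under the diagonal action of SL_n(K) (i.e. f(UA, A^{-1}W) = f(U,W) for all A ∈ SL_n(K) and all (U,W) ∈ X) lies in the K-subalgebra of K[X] generated by the minors p(A,B) for (A,B) ∈ H_p, the maximal minors u(I) for I ∈ I(n,m), and the maximal minors ξ(J) for J ∈ I(n,q). (First fundamental theorem for SL_n(K)-invariants.) -/

import Mathlib

namespace SMB

/-- `geTup f g` : the strictly increasing tuple `f` is `≥` the strictly increasing tuple `g`
in the order on increasing tuples: the length of `f` is at most that of `g`, and `f` is
entrywise `≥` `g` (on the common range of indices). -/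
def geTup {N s s' : ℕ} (f : Fin s → Fin N) (g : Fin s' → Fin N) : Prop :=
  ∃ h : s ≤ s', ∀ j : Fin s, g (Fin.castLE h j) ≤ f j

/-- A strictly increasing `s`-tuple with values in `{1,…,N}` (encoded as `Fin N`). -/
structure IncTup (s N : ℕ) where
  f : Fin s → Fin N
  mono : StrictMono f

/-- A pair of strictly increasing tuples of a common length `s`: row indices in `{1,…,m}`
and column indices in `{1,…,q}`, indexing an `s × s` minor. -/
structure PairIx (m q : ℕ) where
  s : ℕ
  rows : Fin s → Fin m
  cols : Fin s → Fin q
  rmono : StrictMono rows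
  cmono : StrictMono cols

/-- The partial order `(A,B) ⪰ (A',B')` on pairs of increasing tuples: `A ≥ A'` and `B ≥ B'`. -/
def PairIx.ge {m q : ℕ} (x y : PairIx m q) : Prop :=
  geTup x.rows y.rows ∧ geTup x.cols y.cols

end SMB
namespace SMB

variable (K : Type) [Field K] (n m q : ℕ)

/-- The coordinate ring `K[X]` of `X = M_{m,n}(K) × M_{n,q}(K)`: the polynomial ring over `K`
in the entries of a generic `m×n` matrix `U` and a generic `n×q` matrix `W`. -/
abbrev KX := MvPolynomial ((Fin m × Fin n) ⊕ (Fin n × Fin q)) K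

/-- The generic `m×n` matrix `U = (u_{ij})`. -/
noncomputable def Ugen : Matrix (Fin m) (Fin n) (KX K n m q) :=
  Matrix.of fun i j => MvPolynomial.X (Sum.inl (i, j))

/-- The generic `n×q` matrix `W = (ξ_{kl})`. -/
noncomputable def Wgen : Matrix (Fin n) (Fin q) (KX K n m q) :=
  Matrix.of fun k l => MvPolynomial.X (Sum.inr (k, l))

/-- `φ_{ij}`, the `(i,j)` entry of the product matrix `UW`. -/
noncomputable def phi (i : Fin m) (j : Fin q) : KX K n m q :=
  (Ugen K n m q * Wgen K n m q) i j

/-- Evaluation of a polynomial in `K[X]` at a point `(U, W) ∈ X`. -/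
noncomputable def evalX (U : Matrix (Fin m) (Fin n) K) (W : Matrix (Fin n) (Fin q) K) :
    KX K n m q →+* K :=
  MvPolynomial.eval (Sum.elim (fun p => U p.1 p.2) (fun p => W p.1 p.2))

variable {K n m q}

/-- `f ∈ K[X]` is invariant under the diagonal action of `GL_n(K)`:
`f(UA, A⁻¹W) = f(U, W)` for all `A ∈ GL_n(K)` and all `(U,W) ∈ X`. -/
def IsGLInvariant (f : KX K n m q) : Prop :=
  ∀ (A : GL (Fin n) K) (U : Matrix (Fin m) (Fin n) K) (W : Matrix (Fin n) (Fin q) K),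
    evalX K n m q (U * (A : Matrix (Fin n) (Fin n) K))
      (((A⁻¹ : GL (Fin n) K) : Matrix (Fin n) (Fin n) K) * W) f = evalX K n m q U W f

/-- `f ∈ K[X]` is invariant under the diagonal action of `SL_n(K)`:
`f(UA, A⁻¹W) = f(U, W)` for all `A ∈ SL_n(K)` and all `(U,W) ∈ X`. -/
def IsSLInvariant (f : KX K n m q) : Prop :=
  ∀ (A : Matrix.SpecialLinearGroup (Fin n) K)
    (U : Matrix (Fin m) (Fin n) K) (W : Matrix (Fin n) (Fin q) K),
    evalX K n m q (U * (A : Matrix (Fin n) (Fin n) K))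
      (((A⁻¹ : Matrix.SpecialLinearGroup (Fin n) K) : Matrix (Fin n) (Fin n) K) * W) f
      = evalX K n m q U W f

variable (K n m q)

end SMB
namespace SMB

variable (K : Type) [Field K] (n m q : ℕ)

/-- `p(A,B)`: the minor of the product matrix `UW` with row indices `A` and column indices `B`. -/
noncomputable def pPoly (x : PairIx m q) : KX K n m q :=
  Matrix.det (Matrix.of fun i j : Fin x.s =>
    (Ugen K n m q * Wgen K n m q) (x.rows i) (x.cols j))

/-- `u(I)`: the maximal (`n×n`) minor of `U` with row indices `I`. -/
noncomputable def uPoly (I : Fin n → Fin m) : KX K n m q :=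
  Matrix.det (Matrix.of fun i j : Fin n => MvPolynomial.X (Sum.inl (I i, j)))

/-- `ξ(J)`: the maximal (`n×n`) minor of `W` with column indices `J`. -/
noncomputable def xiPoly (J : Fin n → Fin q) : KX K n m q :=
  Matrix.det (Matrix.of fun i j : Fin n => MvPolynomial.X (Sum.inr (i, J j)))

end SMB

namespace SMB

open MvPolynomial MonomialOrder Finset

section KeyOrder

/-- The lexicographic monomial order in which the variable with the smallest key is compared
first. -/
noncomputable def keyOrder {V : Type*} [Finite V] (key : V → ℕ) (hk : Function.Injective key) :
    MonomialOrder V :=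
  letI : LinearOrder V := LinearOrder.lift' key hk
  MonomialOrder.lex

variable {V : Type*} [Finite V] {key : V → ℕ} {hk : Function.Injective key}

lemma keyOrder_lt_iff {a b : V →₀ ℕ} :
    a ≺[keyOrder key hk] b ↔ ∃ v, (∀ v', key v' < key v → a v' = b v') ∧ a v < b v := by
  let _ : LinearOrder V := LinearOrder.lift' key hk
  exact Finsupp.Lex.lt_iff

lemma filter_le_filter_of_le {S : V → Prop} [DecidablePred S]
    (hS : ∀ v v', S v → ¬ S v' → key v < key v') {a b : V →₀ ℕ} (h : a ≼[keyOrder key hk] b) :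
    a.filter S ≼[keyOrder key hk] b.filter S := by
  rcases h.lt_or_eq with h | h
  · obtain ⟨v, h1, h2⟩ := keyOrder_lt_iff.1 h
    by_cases hv : S v
    · refine le_of_lt (keyOrder_lt_iff.2 ⟨v, fun v' hv' => ?_, by simpa [hv] using h2⟩)
      by_cases hS' : S v' <;> simp [hS', h1 v' hv']
    · refine le_of_eq (congrArg _ ?_)
      ext v'
      by_cases hS' : S v'
      · simp [hS', h1 v' (hS _ _ hS' hv)]
      · simp [hS']
  · rw [(keyOrder key hk).toSyn.injective h]

end KeyOrder

section Triangular

variable {V K : Type*} [Field K] [Fintype V]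

/-- A substitution replacing each variable by a monic polynomial with the same leading monomial
preserves the coefficient of any monomial dominating the support. -/
lemma coeff_aeval_of_monic (ord : MonomialOrder V) {θ : V → MvPolynomial V K}
    (hθ : ∀ v, ord.degree (θ v) = Finsupp.single v 1 ∧ ord.Monic (θ v))
    {F : MvPolynomial V K} {D : V →₀ ℕ} (hF : ∀ a ∈ F.support, a ≼[ord] D) :
    coeff D (aeval θ F) = coeff D F := by
  classical
  have key : ∀ a : V →₀ ℕ, a ≼[ord] D →
      coeff D (∏ v, θ v ^ a v) = if a = D then 1 else 0 := by
    intro a ha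
    have hm : ord.Monic (∏ v, θ v ^ a v) := Monic.prod fun v _ => (hθ v).2.pow
    have hd : ord.degree (∏ v, θ v ^ a v) = a := by
      rw [degree_prod fun v _ => pow_ne_zero _ (hθ v).2.ne_zero]
      simp only [degree_pow, (hθ _).1]
      ext v
      simp
    split_ifs with h
    · subst h
      have := hm.coeff_degree
      rwa [hd] at this
    · refine ord.coeff_eq_zero_of_lt ?_
      rw [hd]
      exact lt_of_le_of_ne ha fun h' => h (ord.toSyn.injective h')
  rw [aeval_def, eval₂_eq', coeff_sum]
  simp_rw [algebraMap_eq, coeff_C_mul]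
  rw [sum_congr rfl fun a ha => by rw [key a (hF a ha)]]
  simp only [mul_ite, mul_one, mul_zero, sum_ite_eq', mem_support_iff]
  split_ifs with h
  · rfl
  · exact (not_not.1 h).symm

/-- Substituting weighted homogeneous polynomials of the right weights commutes with taking
weighted homogeneous components. -/
lemma weightedHomogeneousComponent_aeval {M : Type*} [AddCommMonoid M] (w : V → M)
    {θ : V → MvPolynomial V K} (hθ : ∀ v, IsWeightedHomogeneous w (θ v) (w v))
    (e : M) (f : MvPolynomial V K) :
    weightedHomogeneousComponent w e (aeval θ f) = aeval θ (weightedHomogeneousComponent w e f) := by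
  classical
  have hmon : ∀ (a : V →₀ ℕ) (c : K),
      IsWeightedHomogeneous w (aeval θ (monomial a c)) (Finsupp.weight w a) := by
    intro a c
    rw [aeval_monomial, algebraMap_eq, Finsupp.prod_fintype _ _ (by simp), Finsupp.weight_apply,
      Finsupp.sum_fintype _ _ (by simp)]
    exact (IsWeightedHomogeneous.prod _ _ _ fun v _ => (hθ v).pow (a v)).C_mul c
  induction f using MvPolynomial.induction_on' with
  | monomial a c =>
    by_cases h : Finsupp.weight w a = e
    · subst h
      rw [(hmon a c).weightedHomogeneousComponent_same,
        (isWeightedHomogeneous_monomial w a c rfl).weightedHomogeneousComponent_same]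
    · rw [(hmon a c).weightedHomogeneousComponent_ne _ (Ne.symm h),
        (isWeightedHomogeneous_monomial w a c rfl).weightedHomogeneousComponent_ne _ (Ne.symm h), map_zero]
  | add p q hp hq => simp only [map_add, hp, hq]

/-- The value at `p` of the coefficient of `D` in `f`, where `f` is seen as a polynomial in the
variables satisfying `S`. -/
noncomputable def partialCoeff (S : V → Prop) (D : V →₀ ℕ) (f : MvPolynomial V K) (p : V → K) : K :=
  open Classical in
  ∑ a ∈ f.support with a.filter S = D.filter S, coeff a f * ∏ v with ¬ S v, p v ^ a v

open Classical in
lemma prod_partial_pow (S : V → Prop) (p : V → K) (a : V →₀ ℕ) :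
    ∏ v, (if S v then (X v : MvPolynomial V K) else C (p v)) ^ a v
      = monomial (a.filter S) (∏ v with ¬ S v, p v ^ a v) := by
  rw [monomial_eq, Finsupp.prod_fintype _ _ (by simp), map_prod, prod_filter, ← prod_mul_distrib]
  refine prod_congr rfl fun v _ => ?_
  by_cases h : S v <;> simp [h]

open Classical in
lemma coeff_aeval_partial (S : V → Prop) (D : V →₀ ℕ) (f : MvPolynomial V K) (p : V → K) :
    coeff (D.filter S) (aeval (fun v => if S v then X v else C (p v)) f)
      = partialCoeff S D f p := by
  rw [aeval_def, eval₂_eq', coeff_sum, partialCoeff, sum_filter]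
  refine sum_congr rfl fun a _ => ?_
  rw [prod_partial_pow, algebraMap_eq, coeff_C_mul, coeff_monomial]
  split_ifs <;> simp

open Classical in
lemma support_aeval_partial (S : V → Prop) (f : MvPolynomial V K) (p : V → K) {d : V →₀ ℕ}
    (hd : d ∈ (aeval (fun v => if S v then (X v : MvPolynomial V K) else C (p v)) f).support) :
    ∃ a ∈ f.support, a.filter S = d := by
  by_contra! h
  refine mem_support_iff.1 hd ?_
  rw [aeval_def, eval₂_eq', coeff_sum]
  refine sum_eq_zero fun a ha => ?_
  rw [prod_partial_pow, algebraMap_eq, coeff_C_mul, coeff_monomial, if_neg (h a ha), mul_zero]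

end Triangular

section TwoColumns

variable {V N K : Type*} [Field K] [Fintype V] [Fintype N]

lemma exists_partialCoeff_ne_zero [Infinite K] {S : V → Prop} {D : V →₀ ℕ} {f : MvPolynomial V K}
    [DecidablePred S] (hne : ∃ a ∈ f.support, a.filter S = D.filter S) (v w : V) :
    ∃ p : V → K, partialCoeff S D f p ≠ 0 ∧ p v ≠ 0 ∧ p w ≠ 0 := by
  classical
  set T := f.support.filter fun a => a.filter S = D.filter S with hT
  set G : MvPolynomial V K := ∑ a ∈ T, monomial a (coeff a f) with hG
  have hGne : G ≠ 0 := by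
    obtain ⟨a, ha, haS⟩ := hne
    intro h0
    have h1 : coeff a G = 0 := by rw [h0, coeff_zero]
    rw [hG, coeff_sum] at h1
    simp only [coeff_monomial, sum_ite_eq'] at h1
    rw [if_pos (mem_filter.2 ⟨ha, haS⟩)] at h1
    exact mem_support_iff.1 ha h1
  have hne' : G * X v * X w ≠ 0 := mul_ne_zero (mul_ne_zero hGne (X_ne_zero v)) (X_ne_zero w)
  obtain ⟨p, hp⟩ : ∃ p : V → K, eval p (G * X v * X w) ≠ 0 := by
    by_contra! h
    exact hne' (MvPolynomial.funext fun p => by rw [h p, map_zero])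
  simp only [map_mul, eval_X, ne_eq, mul_eq_zero, not_or] at hp
  refine ⟨p, fun h0 => hp.1.1 ?_, hp.1.2, hp.2⟩
  have : eval p G = (∏ u with S u, p u ^ D u) * partialCoeff S D f p := by
    rw [hG, map_sum, partialCoeff, mul_sum]
    refine sum_congr (by rw [hT]; congr!) fun a ha => ?_
    have haS : a.filter S = D.filter S := by convert (mem_filter.1 ha).2
    rw [eval_monomial, Finsupp.prod_fintype _ _ (by simp),
      ← prod_filter_mul_prod_filter_not univ S]
    have : ∏ u with S u, p u ^ a u = ∏ u with S u, p u ^ D u :=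
      prod_congr rfl fun u hu => by
        have := DFunLike.congr_fun haS u
        simp only [Finsupp.filter_apply, (mem_filter.1 hu).2, if_true] at this
        rw [this]
    rw [this]
    simp only [mul_left_comm]
    congr!
  rw [this, h0, mul_zero]

lemma sum_section [DecidableEq V] {row : V → N} {z : N → V} (hz : ∀ i, row (z i) = i) (P : N → Prop)
    [DecidablePred P] (a : V → ℕ) :
    ∑ v with P (row v), (if v = z (row v) then a v else 0) = ∑ i with P i, a (z i) := by
  rw [← sum_filter]
  refine sum_bij' (fun v _ => row v) (fun i _ => z i) ?_ ?_ ?_ ?_ ?_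
  · intro v hv
    simp only [mem_filter, mem_univ, true_and] at hv ⊢
    exact hv.1
  · simp +contextual [hz]
  · exact fun v hv => ((mem_filter.1 hv).2).symm
  · simp [hz]
  · intro v hv
    rw [← (mem_filter.1 hv).2]

/-- The dominance inequality for highest weight vectors: in a bihomogeneous polynomial in `x, y`
fixed by `y ↦ y + η x`, the degree in `y` is at most the degree in `x`, even after discarding the
common factor that is a power of one of the variables `x i`. -/
lemma degree_le_of_partialCoeff_invariant [Infinite K] [DecidableEq V] {row : V → N} {x y : N → V}
    (hx : ∀ i, row (x i) = i) (hy : ∀ i, row (y i) = i) (hxy : ∀ i, x i ≠ y i)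
    {η : N → K} (hη : ∀ i, η i * η i = 1) (P : N → Prop) [DecidablePred P] [DecidableEq N]
    {i₀ : N} {f : MvPolynomial V K} {D : V →₀ ℕ} {A B : ℕ}
    (hne : ∃ a ∈ f.support, a.filter (fun v => ¬ P (row v)) = D.filter (fun v => ¬ P (row v)))
    (hA : ∀ a ∈ f.support, a.filter (fun v => ¬ P (row v)) = D.filter (fun v => ¬ P (row v)) →
      ∑ i with P i, (if i = i₀ then 0 else a (x i)) ≤ A)
    (hB : ∀ a ∈ f.support, a.filter (fun v => ¬ P (row v)) = D.filter (fun v => ¬ P (row v)) →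
      ∑ i with P i, a (y i) = B)
    (hinv : ∀ p : V → K, partialCoeff (fun v => ¬ P (row v)) D f
        (fun v => if v = y (row v) then p v + η (row v) * p (x (row v)) else p v)
      = partialCoeff (fun v => ¬ P (row v)) D f p) : B ≤ A := by
  set g := partialCoeff (fun v => ¬ P (row v)) D f with hg
  have hgp : ∀ p, g p = ∑ a ∈ f.support with
      a.filter (fun v => ¬ P (row v)) = D.filter (fun v => ¬ P (row v)),
      coeff a f * ∏ v with P (row v), p v ^ a v := by
    intro p
    rw [hg, partialCoeff]
    refine sum_congr (by congr!) fun a _ => ?_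
    simp only [not_not]
  have hscale : ∀ (κ : K) (p : V → K),
      g (fun v => if v = y (row v) then κ * p v else p v) = κ ^ B * g p := by
    intro κ p
    rw [hgp, hgp, mul_sum]
    refine sum_congr rfl fun a ha => ?_
    have : ∏ v with P (row v), (if v = y (row v) then κ * p v else p v) ^ a v
        = κ ^ B * ∏ v with P (row v), p v ^ a v := by
      rw [← hB a (mem_filter.1 ha).1 (mem_filter.1 ha).2, ← sum_section hy P a,
        ← prod_pow_eq_pow_sum, ← prod_mul_distrib]
      refine prod_congr rfl fun v _ => ?_
      split_ifs <;> simp [mul_pow]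
    rw [this, mul_left_comm]
  obtain ⟨p, hp, hpx, hpy⟩ := exists_partialCoeff_ne_zero hne (x i₀) (y i₀)
  set κ := -(η i₀ * p (x i₀) / p (y i₀)) with hκ
  have hκ0 : κ ≠ 0 := neg_ne_zero.2 <| div_ne_zero (mul_ne_zero (fun h => by
    have := hη i₀
    simp [h] at this) hpx) hpy
  set p₁ : V → K := fun v => if v = y (row v) then κ * p v else p v with hp₁
  have hgp₁ : g p₁ ≠ 0 := by
    rw [hp₁, hscale]
    exact mul_ne_zero (pow_ne_zero _ hκ0) hp
  have hp₁x : ∀ i, p₁ (x i) = p (x i) := fun i => by simp [hp₁, hx, hxy]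
  have hp₁i : p₁ (x i₀) + η i₀ * p₁ (y i₀) = 0 := by
    rw [hp₁x]
    simp only [hp₁, hy, if_true, hκ]
    have := hη i₀
    field_simp
    linear_combination (- p (x i₀)) * this
  set c : N → K := fun i => p₁ (x i) + η i * p₁ (y i) with hc
  set point : K → V → K := fun s v => if v = x (row v) then
    s * c (row v) - η (row v) * p₁ (y (row v)) else p₁ v with hpoint
  set P' : Polynomial K := ∑ a ∈ f.support with
      a.filter (fun v => ¬ P (row v)) = D.filter (fun v => ¬ P (row v)),
      Polynomial.C (coeff a f) * ∏ v with P (row v), (if v = x (row v) then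
        Polynomial.C (c (row v)) * Polynomial.X
          + Polynomial.C (- (η (row v) * p₁ (y (row v)))) else Polynomial.C (p₁ v)) ^ a v with hP'
  have hPeval : ∀ s, P'.eval s = g (point s) := by
    intro s
    rw [hP', hgp, Polynomial.eval_finsetSum]
    refine sum_congr rfl fun a _ => ?_
    rw [Polynomial.eval_mul, Polynomial.eval_C, Polynomial.eval_prod]
    congr 1
    refine prod_congr rfl fun v _ => ?_
    rw [Polynomial.eval_pow, hpoint]
    dsimp only
    split_ifs
    · simp; ring
    · simp
  have hdeg : P'.natDegree ≤ A := by
    refine Polynomial.natDegree_sum_le_of_forall_le _ _ fun a ha => ?_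
    refine (Polynomial.natDegree_C_mul_le _ _).trans ?_
    refine (Polynomial.natDegree_prod_le _ _).trans ?_
    refine le_trans ?_ (hA a (mem_filter.1 ha).1 (mem_filter.1 ha).2)
    have := sum_section hx P (fun v => if row v = i₀ then 0 else a v)
    simp only [hx] at this
    rw [← this]
    refine sum_le_sum fun v _ => ?_
    refine Polynomial.natDegree_pow_le.trans ?_
    split_ifs with h1 h2
    · rw [h2]
      have : c i₀ = 0 := hp₁i
      simp only [this, map_zero, zero_mul, zero_add, Polynomial.natDegree_C, mul_zero, le_refl]
    · exact (Nat.mul_le_mul_left _ Polynomial.natDegree_linear_le).trans (by simp)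
    · simp
  have hpoint1 : point 1 = p₁ := by
    funext v
    simp only [hpoint, hc]
    split_ifs with h
    · rw [← h]; ring
    · rfl
  have hP0 : P' ≠ 0 := by
    intro h
    have := hPeval 1
    rw [h, hpoint1, Polynomial.eval_zero] at this
    exact hgp₁ this.symm
  set Q : Polynomial K := ∑ a ∈ f.support with
      a.filter (fun v => ¬ P (row v)) = D.filter (fun v => ¬ P (row v)),
      Polynomial.C (coeff a f) * ∏ v with P (row v), (if v = x (row v) then
        Polynomial.C (c (row v)) * Polynomial.X
          + Polynomial.C (- (η (row v) * p₁ (y (row v)))) else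
          if v = y (row v) then Polynomial.C (η (row v) * c (row v))
          else Polynomial.C (p₁ v)) ^ a v with hQ
  have hPQ : P' = Polynomial.X ^ B * Q := by
    refine Polynomial.funext fun s => ?_
    have hQeval : Q.eval s = g (fun v => if v = x (row v) then
        s * c (row v) - η (row v) * p₁ (y (row v)) else
        if v = y (row v) then η (row v) * c (row v) else p₁ v) := by
      rw [hQ, hgp, Polynomial.eval_finsetSum]
      refine sum_congr rfl fun a _ => ?_
      rw [Polynomial.eval_mul, Polynomial.eval_C, Polynomial.eval_prod]
      congr 1
      refine prod_congr rfl fun v _ => ?_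
      rw [Polynomial.eval_pow]
      split_ifs
      · simp; ring
      · simp
      · simp
    rw [Polynomial.eval_mul, Polynomial.eval_pow, Polynomial.eval_X, hQeval, hPeval, ← hscale,
      ← hinv]
    congr 1
    funext v
    by_cases hv : v = y (row v)
    · have hvx : v ≠ x (row v) := fun h => hxy _ (h.symm.trans hv)
      simp only [hpoint, if_neg hvx, if_pos hv, hx, if_true]
      rw [← hv]
      linear_combination (- p₁ v) * hη (row v)
    · simp only [hpoint, if_neg hv]
  rw [hPQ] at hdeg hP0
  have hQ0 : Q ≠ 0 := right_ne_zero_of_mul hP0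
  rw [Polynomial.natDegree_X_pow_mul B hQ0] at hdeg
  omega

end TwoColumns

section LeadingMonomial

variable {V N K : Type*} [Field K] [Fintype V] [Fintype N]

/-- The ballot inequality between two columns `x` and `y` for the leading monomial of a polynomial
fixed by `y ↦ y + η x` and by the corresponding torus. -/
theorem sum_degree_le_of_invariant [Infinite K] [DecidableEq V] {key : V → ℕ}
    (hk : Function.Injective key) {row : V → N} {rk : N → ℕ} (hrk : Function.Injective rk)
    (hkey : ∀ v v', rk (row v') < rk (row v) → key v < key v') {x y : N → V}
    (hx : ∀ i, row (x i) = i) (hy : ∀ i, row (y i) = i) (hxy : ∀ i, key (y i) < key (x i))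
    {η : N → K} (hη : ∀ i, η i * η i = 1) {f : MvPolynomial V K} (hf : f ≠ 0)
    (hinv : aeval (fun v => if v = y (row v) then X v + C (η (row v)) * X (x (row v)) else X v) f
      = f)
    (hwt : ∀ a ∈ f.support, ∑ i, a (x i) = ∑ i, a (y i)) (i₀ : N) :
    ∑ i with rk i ≤ rk i₀, (keyOrder key hk).degree f (y i)
      ≤ ∑ i with rk i < rk i₀, (keyOrder key hk).degree f (x i) := by
  classical
  set ord := keyOrder key hk with hord
  set M := ord.degree f with hM
  have hxy' : ∀ i, x i ≠ y i := fun i h => (hxy i).ne (congrArg key h.symm)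
  set w : V → (V →₀ ℕ) := fun v =>
    if v = y (row v) then Finsupp.single (x (row v)) 1 else Finsupp.single v 1 with hw
  set θ : V → MvPolynomial V K := fun v =>
    if v = y (row v) then X v + C (η (row v)) * X (x (row v)) else X v with hθ
  have hwx : ∀ i, w (x i) = Finsupp.single (x i) 1 := fun i => by simp [hw, hx, hxy']
  have hθw : ∀ v, IsWeightedHomogeneous w (θ v) (w v) := by
    intro v
    simp only [hθ]
    split_ifs with h
    · refine (isWeightedHomogeneous_X K w v).add ?_
      have : w v = w (x (row v)) := by rw [hwx]; simp only [hw, if_pos h]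
      rw [this]
      exact (isWeightedHomogeneous_X K w _).C_mul _
    · exact isWeightedHomogeneous_X K w v
  set f' := weightedHomogeneousComponent w (Finsupp.weight w M) f with hf'
  have hf'inv : aeval θ f' = f' := by
    rw [hf', ← weightedHomogeneousComponent_aeval w hθw, hinv]
  have hmem : ∀ a, a ∈ f'.support ↔ a ∈ f.support ∧ Finsupp.weight w a = Finsupp.weight w M := by
    intro a
    rw [hf', support_weightedHomogeneousComponent, mem_filter]
  have hMf : M ∈ f'.support := (hmem M).2 ⟨ord.degree_mem_support hf, rfl⟩
  have hweight : ∀ (a : V →₀ ℕ) v, Finsupp.weight w a v =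
      if v = y (row v) then 0 else if v = x (row v) then a v + a (y (row v)) else a v := by
    intro a v
    rw [Finsupp.weight_apply, Finsupp.sum_fintype _ _ (by simp), Finsupp.finsetSum_apply]
    simp only [Finsupp.smul_apply, smul_eq_mul, hw]
    have hterm : ∀ u, (a u * (if u = y (row u) then Finsupp.single (x (row u)) 1
          else Finsupp.single u 1 : V →₀ ℕ) v)
        = (if u = v then (if v = y (row v) then 0 else a v) else 0)
          + (if u = y (row v) then (if v = x (row v) then a u else 0) else 0) := by
      intro u
      by_cases h1 : u = y (row u)
      · rw [if_pos h1]
        by_cases h2 : x (row u) = v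
        · have h3 : row v = row u := by rw [← h2, hx]
          have h4 : u ≠ v := fun h => hxy' (row u) (h2.trans (h.symm.trans h1))
          have h5 : u = y (row v) := by rw [h3]; exact h1
          have h6 : v = x (row v) := by rw [h3]; exact h2.symm
          rw [Finsupp.single_apply, if_pos h2, if_neg h4, if_pos h5, if_pos h6]
          simp
        · rw [Finsupp.single_apply, if_neg h2]
          by_cases h4 : u = v
          · subst h4
            rw [if_pos rfl, if_pos h1, if_pos h1, if_neg (Ne.symm h2)]
            simp
          · rw [if_neg h4]
            by_cases h5 : u = y (row v)
            · have h3 : row u = row v := by rw [h5, hy]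
              rw [if_pos h5, if_neg (by rw [← h3]; exact Ne.symm h2)]
              simp
            · rw [if_neg h5]; simp
      · rw [if_neg h1, Finsupp.single_apply]
        have h5 : u ≠ y (row v) := fun h => h1 (by
          have : row u = row v := by rw [h, hy]
          rw [this]; exact h)
        rw [if_neg h5]
        by_cases h4 : u = v
        · subst h4
          simp [h1]
        · simp [h4]
    rw [sum_congr rfl fun u _ => hterm u, sum_add_distrib]
    simp only [sum_ite_eq', mem_univ, if_true]
    split_ifs with h1 h2 h2
    · exact absurd (h2.symm.trans h1) (hxy' _)
    · rfl
    · rfl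
    · rfl
  have hrows : ∀ a ∈ f'.support, ∀ i, a (x i) + a (y i) = M (x i) + M (y i) := by
    intro a ha i
    have := DFunLike.congr_fun ((hmem a).1 ha).2 (x i)
    simpa [hweight, hx, hxy'] using this
  have hother : ∀ a ∈ f'.support, ∀ v, v ≠ x (row v) → v ≠ y (row v) → a v = M v := by
    intro a ha v h1 h2
    have := DFunLike.congr_fun ((hmem a).1 ha).2 v
    simpa [hweight, h1, h2] using this
  set P : N → Prop := fun i => rk i ≤ rk i₀ with hP
  have hhigh : ∀ a : V →₀ ℕ, a.filter (fun v => ¬ P (row v)) = M.filter (fun v => ¬ P (row v)) →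
      ∀ v, ¬ P (row v) → a v = M v := by
    intro a ha v hv
    have := DFunLike.congr_fun ha v
    simpa [Finsupp.filter_apply, hv] using this
  have hsplit : ∀ z : N → ℕ, ∑ i, z i = ∑ i with P i, z i + ∑ i with ¬ P i, z i :=
    fun z => (sum_filter_add_sum_filter_not univ P z).symm
  have hsums : ∀ a ∈ f'.support,
      a.filter (fun v => ¬ P (row v)) = M.filter (fun v => ¬ P (row v)) →
      ∑ i with P i, a (x i) = ∑ i with P i, M (x i) ∧
      ∑ i with P i, a (y i) = ∑ i with P i, M (y i) := by
    intro a ha haS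
    have e1 := hwt a ((hmem a).1 ha).1
    have e2 := hwt M ((hmem M).1 hMf).1
    have e3 : ∑ i with P i, a (x i) + ∑ i with P i, a (y i)
        = ∑ i with P i, M (x i) + ∑ i with P i, M (y i) := by
      rw [← sum_add_distrib, ← sum_add_distrib]
      exact sum_congr rfl fun i _ => hrows a ha i
    have e4 : ∑ i with ¬ P i, a (x i) = ∑ i with ¬ P i, M (x i) :=
      sum_congr rfl fun i hi => hhigh a haS _ (by rw [hx]; exact (mem_filter.1 hi).2)
    have e5 : ∑ i with ¬ P i, a (y i) = ∑ i with ¬ P i, M (y i) :=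
      sum_congr rfl fun i hi => hhigh a haS _ (by rw [hy]; exact (mem_filter.1 hi).2)
    rw [hsplit, hsplit (fun i => a (y i))] at e1
    rw [hsplit, hsplit (fun i => M (y i))] at e2
    omega
  have hle : ∀ a ∈ f'.support, a ≼[ord] M := fun a ha => ord.le_degree ((hmem a).1 ha).1
  have hS : ∀ v v', ¬ P (row v) → ¬¬ P (row v') → key v < key v' := fun v v' h h' =>
    hkey _ _ (lt_of_le_of_lt (not_not.1 h') (not_le.1 h))
  have hpivot : ∀ a ∈ f'.support,
      a.filter (fun v => ¬ P (row v)) = M.filter (fun v => ¬ P (row v)) →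
      M (x i₀) ≤ a (x i₀) := by
    intro a ha haS
    by_contra! hlt
    have hr := hrows a ha i₀
    refine absurd (hle a ha) (not_le.2 (keyOrder_lt_iff.2 ⟨y i₀, fun v hv => ?_, by omega⟩))
    rcases lt_trichotomy (rk (row v)) (rk i₀) with h | h | h
    · have := hkey (y i₀) v (by rwa [hy])
      omega
    · have h' := hrk h
      refine (hother a ha v ?_ ?_).symm
      · intro h2
        rw [h2, h'] at hv
        exact absurd hv (hxy i₀).le.not_gt
      · intro h2
        rw [h2, h'] at hv
        exact lt_irrefl _ hv
    · exact (hhigh a haS v (not_le.2 h)).symm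
  refine degree_le_of_partialCoeff_invariant hx hy hxy' hη P (i₀ := i₀) (f := f') (D := M)
    ⟨M, hMf, rfl⟩ ?_ (fun a ha haS => (hsums a ha haS).2) ?_
  · intro a ha haS
    have h1 := (hsums a ha haS).1
    have h2 := hpivot a ha haS
    have h3 : ∀ b : V →₀ ℕ, ∑ i with P i, b (x i)
        = b (x i₀) + ∑ i with P i, (if i = i₀ then 0 else b (x i)) := by
      intro b
      have hi₀ : i₀ ∈ univ.filter P := by simp [hP]
      rw [← add_sum_erase _ _ hi₀, ← add_sum_erase (univ.filter P)
        (fun i => if i = i₀ then 0 else b (x i)) hi₀, if_pos rfl, zero_add]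
      congr 1
      exact sum_congr rfl fun i hi => by rw [if_neg (ne_of_mem_erase hi)]
    have h4 : ∑ i with P i, (if i = i₀ then 0 else M (x i)) = ∑ i with rk i < rk i₀, M (x i) := by
      rw [sum_filter, sum_filter]
      refine sum_congr rfl fun i _ => ?_
      by_cases h : i = i₀
      · simp [h]
      · have : rk i ≠ rk i₀ := fun h' => h (hrk h')
        by_cases h' : rk i < rk i₀
        · simp [hP, h, h', h'.le]
        · simp [hP, h', show ¬ rk i ≤ rk i₀ by omega]
    rw [h3 a, h3 M] at h1
    omega
  · intro p
    obtain ⟨S, hSdef⟩ : ∃ S : V → Prop, S = fun v => ¬ P (row v) := ⟨_, rfl⟩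
    rw [← hSdef]
    set p' : V → K := fun v => if v = y (row v) then p v + η (row v) * p (x (row v)) else p v
      with hp'
    set θ' : V → MvPolynomial V K := fun v => if S v then θ v else X v with hθ'
    have hcomp : aeval (fun v => if S v then (X v : MvPolynomial V K) else C (p v)) (aeval θ f')
        = aeval θ' (aeval (fun v => if S v then (X v : MvPolynomial V K) else C (p' v)) f') := by
      rw [← AlgHom.comp_apply, ← AlgHom.comp_apply]
      congr 1
      refine MvPolynomial.algHom_ext fun v => ?_
      simp only [AlgHom.comp_apply, aeval_X]
      have hSx : S (x (row v)) ↔ S v := by simp [hSdef, hx]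
      by_cases hSv : S v
      · simp only [hθ, hθ', if_pos hSv, aeval_X]
        split_ifs
        · simp [hSx, hSv]
        · simp [hSv]
      · simp only [hθ, hp', if_neg hSv, algHom_C]
        split_ifs
        · simp [algHom_C, hSx, hSv]
        · simp [hSv]
    have hmonic : ∀ v, ord.degree (θ' v) = Finsupp.single v 1 ∧ ord.Monic (θ' v) := by
      intro v
      simp only [hθ', hθ]
      have hX : ord.degree (X v : MvPolynomial V K) = Finsupp.single v 1 ∧
          ord.Monic (X v : MvPolynomial V K) := ⟨ord.degree_X, ord.monic_X⟩
      split_ifs with h1 h2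
      · have hlt : ord.degree (C (η (row v)) * X (x (row v)) : MvPolynomial V K)
            ≺[ord] ord.degree (X v : MvPolynomial V K) := by
          rw [hX.1]
          refine lt_of_le_of_lt (b := ord.toSyn (Finsupp.single (x (row v)) 1)) ?_ ?_
          · rw [C_mul_X_eq_monomial]
            exact ord.degree_monomial_le _
          · have hv : key v < key (x (row v)) := by
              conv_lhs => rw [h2]
              exact hxy _
            refine keyOrder_lt_iff.2 ⟨v, fun v' hv' => ?_, ?_⟩
            · rw [Finsupp.single_apply, Finsupp.single_apply, if_neg, if_neg]
              · rintro rfl; exact lt_irrefl _ hv'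
              · rintro rfl; exact lt_asymm hv hv'
            · rw [Finsupp.single_apply, if_neg]
              · simp
              · intro h; rw [h] at hv; exact lt_irrefl _ hv
        exact ⟨by rw [degree_add_of_lt hlt, hX.1], hX.2.add_of_lt hlt⟩
      · exact hX
      · exact hX
    rw [← coeff_aeval_partial, ← coeff_aeval_partial]
    conv_rhs => rw [← hf'inv, hcomp]
    refine (coeff_aeval_of_monic ord hmonic fun d hd => ?_).symm
    obtain ⟨a, ha, rfl⟩ := support_aeval_partial S f' p' hd
    exact filter_le_filter_of_le (by rw [hSdef]; exact hS) (hle a ha)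

end LeadingMonomial

section Coordinates

variable {n m q : ℕ}

/-- The coordinates on `X` in the order in which the monomial order compares them. -/
def coordKey : (Fin m × Fin n) ⊕ (Fin n × Fin q) → ℕ
  | .inl (i, j) => q * n + finProdFinEquiv (i.rev, j.rev)
  | .inr (k, l) => finProdFinEquiv (l, k)

lemma coordKey_injective : Function.Injective (coordKey (n := n) (m := m) (q := q)) := by
  rintro (⟨i, j⟩ | ⟨k, l⟩) (⟨i', j'⟩ | ⟨k', l'⟩) h
  · simp only [coordKey, add_right_inj, Fin.val_inj, EmbeddingLike.apply_eq_iff_eq,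
      Prod.mk.injEq, Fin.rev_inj] at h
    rw [h.1, h.2]
  · have := (finProdFinEquiv (l', k')).2
    simp only [coordKey] at h
    omega
  · have := (finProdFinEquiv (l, k)).2
    simp only [coordKey] at h
    omega
  · simp only [coordKey, Fin.val_inj, EmbeddingLike.apply_eq_iff_eq, Prod.mk.injEq] at h
    rw [h.1, h.2]

/-- The monomial order on `K[X]`: lexicographic, the entries of `W` coming first. -/
noncomputable abbrev coordOrder (n m q : ℕ) : MonomialOrder ((Fin m × Fin n) ⊕ (Fin n × Fin q)) :=
  keyOrder coordKey coordKey_injective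

/-- The row of `U`, or column of `W`, containing a coordinate. -/
def vec : (Fin m × Fin n) ⊕ (Fin n × Fin q) → Fin m ⊕ Fin q
  | .inl (i, _) => .inl i
  | .inr (_, l) => .inr l

/-- The rank of a row of `U` or a column of `W`; larger ranks are compared first. -/
def vecRank : Fin m ⊕ Fin q → ℕ
  | .inl i => i
  | .inr l => m + l.rev

lemma vecRank_injective : Function.Injective (vecRank (m := m) (q := q)) := by
  rintro (i | l) (i' | l') h <;> simp only [vecRank] at h
  · rw [Fin.ext h]
  · have := i.2; omega
  · have := i'.2; omega
  · rw [Fin.rev_injective (Fin.ext (show (l.rev : ℕ) = l'.rev by omega))]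

lemma coordKey_lt_of_vecRank_lt (v v' : (Fin m × Fin n) ⊕ (Fin n × Fin q))
    (h : vecRank (vec v') < vecRank (vec v)) : coordKey v < coordKey v' := by
  have aux : ∀ {a : ℕ} (x x' : Fin a) (y y' : Fin n), x < x' →
      (finProdFinEquiv (x, y) : ℕ) < finProdFinEquiv (x', y') := by
    intro a x x' y y' hx
    simp only [finProdFinEquiv_apply_val]
    have h1 : n * (x + 1) ≤ n * x' := Nat.mul_le_mul_left _ hx
    have := y.2
    have := y'.2
    rw [mul_add] at h1
    omega
  rcases v with ⟨i, j⟩ | ⟨k, l⟩ <;> rcases v' with ⟨i', j'⟩ | ⟨k', l'⟩ <;>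
    simp only [vec, vecRank, coordKey] at h ⊢
  · exact Nat.add_lt_add_left (aux _ _ _ _ (Fin.rev_lt_rev.2 h)) _
  · have := i.2; omega
  · have := (finProdFinEquiv (l, k)).2; omega
  · exact aux _ _ _ _ (Fin.rev_lt_rev.1 (Nat.add_lt_add_iff_left.1 h))

end Coordinates

section Invariants

variable {K : Type} [Field K] {n m q : ℕ}

lemma aeval_eq_self_of_isSLInvariant [Infinite K] {f : KX K n m q} (hf : IsSLInvariant f)
    {A B : Matrix (Fin n) (Fin n) K} (hA : A.det = 1) (hAB : A * B = 1)
    {θ : (Fin m × Fin n) ⊕ (Fin n × Fin q) → KX K n m q}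
    (hU : ∀ p i j, eval p (θ (.inl (i, j))) = ∑ k, p (.inl (i, k)) * A k j)
    (hW : ∀ p k l, eval p (θ (.inr (k, l))) = ∑ k', B k k' * p (.inr (k', l))) :
    aeval θ f = f := by
  refine MvPolynomial.funext fun p => ?_
  obtain ⟨A, rfl⟩ : ∃ A' : Matrix.SpecialLinearGroup (Fin n) K, (A' : Matrix (Fin n) (Fin n) K) = A :=
    ⟨⟨A, hA⟩, rfl⟩
  have hinv : ((A⁻¹ : Matrix.SpecialLinearGroup (Fin n) K) : Matrix (Fin n) (Fin n) K) = B := by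
    rw [Matrix.SpecialLinearGroup.coe_inv]
    have h := Matrix.adjugate_mul (A : Matrix (Fin n) (Fin n) K)
    rw [A.det_coe, one_smul] at h
    exact left_inv_eq_right_inv h hAB
  have h := hf A (Matrix.of fun i j => p (.inl (i, j))) (Matrix.of fun k l => p (.inr (k, l)))
  rw [hinv] at h
  unfold evalX at h
  have h1 : (Sum.elim (fun a : Fin m × Fin n => p (.inl (a.1, a.2)))
      (fun a : Fin n × Fin q => p (.inr (a.1, a.2)))) = p := by
    ext (⟨i, j⟩ | ⟨k, l⟩) <;> rfl
  simp only [Matrix.of_apply, h1] at h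
  rw [← h]
  have h2 : eval p (aeval θ f) = eval (fun v => eval p (θ v)) f := by
    rw [← MvPolynomial.coe_aeval_eq_eval, ← MvPolynomial.coe_aeval_eq_eval]
    simp only [RingHom.coe_coe]
    rw [← AlgHom.comp_apply, comp_aeval]
  rw [h2]
  congr 1
  congr 1
  ext (⟨i, j⟩ | ⟨k, l⟩)
  · simp [hU, Matrix.mul_apply]
  · simp [hW, Matrix.mul_apply]

lemma prod_pow_eq_one_of_aeval_eq_self {V : Type*} [Fintype V] {c : V → K} {f : MvPolynomial V K}
    (h : aeval (fun v => C (c v) * X v) f = f) {a : V →₀ ℕ} (ha : a ∈ f.support) :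
    ∏ v, c v ^ a v = 1 := by
  classical
  have hmon : ∀ b : V →₀ ℕ, ∏ v, (C (c v) * X v : MvPolynomial V K) ^ b v
      = monomial b (∏ v, c v ^ b v) := by
    intro b
    rw [monomial_eq, Finsupp.prod_fintype _ _ (by simp), map_prod, ← prod_mul_distrib]
    simp [mul_pow]
  have h1 : coeff a (aeval (fun v => C (c v) * X v) f) = coeff a f * ∏ v, c v ^ a v := by
    rw [aeval_def, eval₂_eq', coeff_sum, sum_eq_single a]
    · rw [hmon, algebraMap_eq, coeff_C_mul, coeff_monomial, if_pos rfl]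
    · intro b _ hb
      rw [hmon, algebraMap_eq, coeff_C_mul, coeff_monomial, if_neg hb, mul_zero]
    · exact fun h => absurd ha h
  rw [h] at h1
  exact mul_left_cancel₀ (mem_support_iff.1 ha) (h1.symm.trans (mul_one _).symm)

lemma sum_eq_sum_of_torus_invariant [Infinite K] {V N : Type*} [Fintype V] [Fintype N]
    [DecidableEq V] {row : V → N} {x y : N → V} (hx : ∀ i, row (x i) = i) (hy : ∀ i, row (y i) = i)
    (hxy : ∀ i, x i ≠ y i) {f : MvPolynomial V K}
    (h : ∀ t : K, t ≠ 0 → aeval (fun v => C (if v = x (row v) then t else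
      if v = y (row v) then t⁻¹ else 1) * X v) f = f) {a : V →₀ ℕ} (ha : a ∈ f.support) :
    ∑ i, a (x i) = ∑ i, a (y i) := by
  have key : ∀ t : K, t ≠ 0 → t ^ ∑ i, a (x i) = t ^ ∑ i, a (y i) := by
    intro t ht
    have h1 := prod_pow_eq_one_of_aeval_eq_self (h t ht) ha
    have h2 : ∀ v, (if v = x (row v) then t else if v = y (row v) then t⁻¹ else 1) ^ a v
        = t ^ (if v = x (row v) then a v else 0) * t⁻¹ ^ (if v = y (row v) then a v else 0) := by
      intro v
      by_cases hv : v = x (row v)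
      · have : v ≠ y (row v) := fun hv' => hxy _ (hv.symm.trans hv')
        simp only [if_pos hv, if_neg this, pow_zero, mul_one]
      · simp only [if_neg hv, pow_zero, one_mul]
        split_ifs <;> simp
    simp_rw [h2] at h1
    have sx := sum_section hx (fun _ => True) a
    have sy := sum_section hy (fun _ => True) a
    simp only [filter_true] at sx sy
    rw [prod_mul_distrib, prod_pow_eq_pow_sum, prod_pow_eq_pow_sum, sx, sy, inv_pow] at h1
    exact (mul_inv_eq_one₀ (pow_ne_zero _ ht)).1 h1
  have hpoly : (Polynomial.X ^ (∑ i, a (x i) + 1) : Polynomial K)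
      = Polynomial.X ^ (∑ i, a (y i) + 1) := by
    refine Polynomial.funext fun t => ?_
    by_cases ht : t = 0
    · simp [ht]
    · simp [pow_succ, key t ht]
  have := congrArg Polynomial.natDegree hpoly
  simpa using this

/-- For neighbouring columns `j < j'` of `U`, the coordinate of each vector that is added. -/
def addedCoord (j j' : Fin n) : Fin m ⊕ Fin q → (Fin m × Fin n) ⊕ (Fin n × Fin q)
  | .inl i => .inl (i, j)
  | .inr l => .inr (j', l)

/-- For neighbouring columns `j < j'` of `U`, the coordinate of each vector that is changed. -/
def changedCoord (j j' : Fin n) : Fin m ⊕ Fin q → (Fin m × Fin n) ⊕ (Fin n × Fin q)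
  | .inl i => .inl (i, j')
  | .inr l => .inr (j, l)

lemma vec_addedCoord (j j' : Fin n) (i : Fin m ⊕ Fin q) : vec (addedCoord j j' i) = i := by
  rcases i with i | l <;> rfl

lemma vec_changedCoord (j j' : Fin n) (i : Fin m ⊕ Fin q) : vec (changedCoord j j' i) = i := by
  rcases i with i | l <;> rfl

lemma coordKey_changedCoord_lt {j j' : Fin n} (hj : j < j') (i : Fin m ⊕ Fin q) :
    coordKey (changedCoord j j' i) < coordKey (addedCoord j j' i) := by
  rcases i with i | l
  · have := Fin.rev_lt_rev.2 hj
    simp [changedCoord, addedCoord, coordKey]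
    omega
  · simp [changedCoord, addedCoord, coordKey]
    omega

variable [Infinite K] {f : KX K n m q}

lemma weight_eq_of_isSLInvariant (hf : IsSLInvariant f) {j j' : Fin n} (hj : j ≠ j')
    {a : (Fin m × Fin n) ⊕ (Fin n × Fin q) →₀ ℕ} (ha : a ∈ f.support) :
    ∑ i, a (addedCoord j j' i) = ∑ i, a (changedCoord j j' i) := by
  refine sum_eq_sum_of_torus_invariant (vec_addedCoord j j') (vec_changedCoord j j') ?_
    (fun t ht => ?_) ha
  · rintro (i | l) <;> simp [addedCoord, changedCoord, hj, hj.symm]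
  set d : Fin n → K := fun k => if k = j then t else if k = j' then t⁻¹ else 1 with hd
  set d' : Fin n → K := fun k => if k = j' then t else if k = j then t⁻¹ else 1 with hd'
  have hdd : ∀ k, d k * d' k = 1 := by
    intro k
    by_cases h1 : k = j
    · have h2 : k ≠ j' := h1 ▸ hj
      simp [hd, hd', h1, hj, ht]
    · by_cases h2 : k = j' <;> simp [hd, hd', h1, h2, hj.symm, ht]
  refine aeval_eq_self_of_isSLInvariant hf (A := Matrix.diagonal d) (B := Matrix.diagonal d')
    ?_ ?_ ?_ ?_
  · rw [Matrix.det_diagonal, ← mul_prod_erase _ _ (mem_univ j),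
      ← mul_prod_erase _ _ (mem_erase.2 ⟨hj.symm, mem_univ j'⟩), prod_eq_one]
    · simp [hd, hj.symm, ht]
    · intro k hk
      simp only [mem_erase, mem_univ, and_true] at hk
      simp [hd, hk.1, hk.2]
  · rw [Matrix.diagonal_mul_diagonal, ← Matrix.diagonal_one]
    congr 1
    ext k
    exact hdd k
  · intro p i k
    rw [sum_eq_single k]
    · simp [addedCoord, changedCoord, vec, hd, mul_comm]
    · intro k' _ hk'
      simp [hk']
    · simp
  · intro p k l
    rw [sum_eq_single k]
    · simp [addedCoord, changedCoord, vec, hd']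
    · intro k' _ hk'
      simp [hk'.symm]
    · simp

lemma aeval_transvection_of_isSLInvariant (hf : IsSLInvariant f) {j j' : Fin n} (hj : j ≠ j') :
    aeval (fun v => if v = changedCoord j j' (vec v) then
      X v + C (Sum.elim (fun _ => 1) (fun _ => -1) (vec v)) * X (addedCoord j j' (vec v))
      else X v) f = f := by
  refine aeval_eq_self_of_isSLInvariant hf (A := Matrix.transvection j j' 1)
    (B := Matrix.transvection j j' (-1)) (Matrix.det_transvection_of_ne _ _ hj _) ?_ ?_ ?_
  · rw [Matrix.transvection_mul_transvection_same _ _ hj]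
    simp
  · intro p i k
    simp only [changedCoord, addedCoord, vec, Matrix.transvection, Matrix.add_apply, mul_add,
      sum_add_distrib, Matrix.one_apply, Matrix.single_apply]
    by_cases h : k = j'
    · simp [h]
    · simp [h, Ne.symm h]
  · intro p k l
    simp only [changedCoord, addedCoord, vec, Matrix.transvection, Matrix.add_apply, add_mul,
      sum_add_distrib, Matrix.one_apply, Matrix.single_apply]
    by_cases h : k = j
    · simp [h]
    · simp [h, Ne.symm h]

lemma ballot_of_isSLInvariant (hf : IsSLInvariant f) (hf0 : f ≠ 0) {j j' : Fin n} (hj : j < j') (i₀ : Fin m ⊕ Fin q) :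
    ∑ i with vecRank i ≤ vecRank i₀, (coordOrder n m q).degree f (changedCoord j j' i)
      ≤ ∑ i with vecRank i < vecRank i₀, (coordOrder n m q).degree f (addedCoord j j' i) :=
  sum_degree_le_of_invariant coordKey_injective vecRank_injective coordKey_lt_of_vecRank_lt
    (vec_addedCoord j j') (vec_changedCoord j j') (coordKey_changedCoord_lt hj)
    (η := Sum.elim (fun _ => 1) (fun _ => -1)) (by rintro (i | l) <;> simp) hf0
    (aeval_transvection_of_isSLInvariant hf hj.ne)
    (fun _ ha => weight_eq_of_isSLInvariant hf hj.ne ha) i₀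

end Invariants

section SumSingle

variable {V K ι : Type*} [Field K] [Fintype ι]

lemma degree_sum_monomial (ord : MonomialOrder V) {e : ι → V →₀ ℕ} {c : ι → K} {t₀ : ι}
    (h1 : c t₀ = 1) (h : ∀ t, t ≠ t₀ → e t ≺[ord] e t₀) :
    ord.degree (∑ t, monomial (e t) (c t)) = e t₀ ∧ ∑ t, monomial (e t) (c t) ≠ 0 := by
  classical
  have hc : coeff (e t₀) (∑ t, monomial (e t) (c t)) = 1 := by
    rw [coeff_sum, sum_eq_single t₀]
    · rw [coeff_monomial, if_pos rfl, h1]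
    · intro t _ ht
      rw [coeff_monomial, if_neg]
      intro h'
      have := h t ht
      rw [h'] at this
      exact lt_irrefl _ this
    · simp
  refine ⟨?_, fun h0 => by simp [h0] at hc⟩
  apply ord.toSyn.injective
  refine le_antisymm (ord.degree_le_iff.2 fun a ha => ?_) (ord.le_degree ?_)
  · have : ∃ t, e t = a := by
      by_contra! h'
      refine mem_support_iff.1 ha ?_
      rw [coeff_sum]
      exact sum_eq_zero fun t _ => by rw [coeff_monomial, if_neg (h' t)]
    obtain ⟨t, rfl⟩ := this
    by_cases ht : t = t₀
    · rw [ht]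
    · exact (h t ht).le
  · rw [mem_support_iff, hc]
    exact one_ne_zero

lemma prod_X_eq_monomial (x : ι → V) :
    ∏ i, (X (x i) : MvPolynomial V K) = monomial (∑ i, Finsupp.single (x i) 1) 1 := by
  rw [monomial_sum_one]
  rfl

lemma sum_single_lt [Finite V] {key : V → ℕ} {hk : Function.Injective key} {x y : ι → V} {i₀ : ι}
    (h : ∀ i, x i = y i ∨ key (y i₀) < key (x i) ∧ key (y i₀) ≤ key (y i)) (h₀ : x i₀ ≠ y i₀)
    {a b : V →₀ ℕ} (hab : ∀ v, key v ≤ key (y i₀) → a v = b v) :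
    (∑ i, Finsupp.single (x i) 1 + a) ≺[keyOrder key hk] (∑ i, Finsupp.single (y i) 1 + b) := by
  classical
  have hx : ∀ i v, x i ≠ y i → key v ≤ key (y i₀) → Finsupp.single (x i) 1 v = 0 := by
    intro i v hi hv
    rw [Finsupp.single_apply, if_neg]
    rintro rfl
    have := (h i).resolve_left hi
    omega
  refine keyOrder_lt_iff.2 ⟨y i₀, fun v hv => ?_, ?_⟩
  · rw [Finsupp.add_apply, Finsupp.add_apply, hab v hv.le, Finsupp.finsetSum_apply,
      Finsupp.finsetSum_apply]
    congr 1
    refine sum_congr rfl fun i _ => ?_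
    by_cases hi : x i = y i
    · rw [hi]
    · rw [hx i v hi hv.le, Finsupp.single_apply, if_neg]
      rintro rfl
      have := (h i).resolve_left hi
      omega
  · rw [Finsupp.add_apply, Finsupp.add_apply, hab _ le_rfl, Finsupp.finsetSum_apply,
      Finsupp.finsetSum_apply]
    refine Nat.add_lt_add_right (sum_lt_sum (fun i _ => ?_) ⟨i₀, mem_univ _, ?_⟩) _
    · by_cases hi : x i = y i
      · rw [hi]
      · rw [hx i _ hi le_rfl]
        exact Nat.zero_le _
    · rw [hx i₀ _ h₀ le_rfl]
      simp

end SumSingle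

section Minors

variable {K : Type} [Field K] {n m q s : ℕ}

/-- The exponent of the product of the entries `(A i, c i)` of `U`. -/
noncomputable def uExp (q : ℕ) (A : Fin s → Fin m) (c : Fin s → Fin n) :
    (Fin m × Fin n) ⊕ (Fin n × Fin q) →₀ ℕ :=
  ∑ i, Finsupp.single (.inl (A i, c i)) 1

/-- The exponent of the product of the entries `(c i, B i)` of `W`. -/
noncomputable def wExp (m : ℕ) (c : Fin s → Fin n) (B : Fin s → Fin q) :
    (Fin m × Fin n) ⊕ (Fin n × Fin q) →₀ ℕ :=
  ∑ i, Finsupp.single (.inr (c i, B i)) 1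

lemma coordKey_inl_lt {i i' : Fin m} (j j' : Fin n) (h : i < i') :
    coordKey (.inl (i', j') : (Fin m × Fin n) ⊕ (Fin n × Fin q)) <
      coordKey (.inl (i, j) : (Fin m × Fin n) ⊕ (Fin n × Fin q)) :=
  coordKey_lt_of_vecRank_lt _ _ h

lemma coordKey_inr_lt {l l' : Fin q} (k k' : Fin n) (h : l < l') :
    coordKey (.inr (k, l) : (Fin m × Fin n) ⊕ (Fin n × Fin q)) <
      coordKey (.inr (k', l') : (Fin m × Fin n) ⊕ (Fin n × Fin q)) :=
  coordKey_lt_of_vecRank_lt _ _ (Nat.add_lt_add_left (Fin.rev_lt_rev.2 h) m)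

lemma coordKey_inr_lt_inl (p : Fin m × Fin n) (p' : Fin n × Fin q) :
    coordKey (.inr p' : (Fin m × Fin n) ⊕ (Fin n × Fin q)) <
      coordKey (.inl p : (Fin m × Fin n) ⊕ (Fin n × Fin q)) := by
  refine coordKey_lt_of_vecRank_lt _ _ ?_
  have := p.1.2
  simp only [vec, vecRank]
  omega

lemma uExp_lt {A : Fin s → Fin m} (hA : StrictMono A) (h : s ≤ n) {σ : Equiv.Perm (Fin s)}
    (hσ : σ ≠ 1) (b : (Fin m × Fin n) ⊕ (Fin n × Fin q) →₀ ℕ) :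
    (uExp q (fun i => A (σ i)) (Fin.castLE h) + b) ≺[coordOrder n m q]
      (uExp q A (Fin.castLE h) + b) := by
  have hre : uExp q (fun i => A (σ i)) (Fin.castLE h)
      = uExp q A (fun i => Fin.castLE h (σ.symm i)) := by
    unfold uExp
    rw [← Equiv.sum_comp σ fun i => Finsupp.single (Sum.inl (A i, Fin.castLE h (σ.symm i))) 1]
    simp
  have hne : (univ.filter fun i => σ.symm i ≠ i).Nonempty := by
    by_contra! h'
    refine hσ (inv_eq_one.1 (Equiv.ext fun i => ?_))
    by_contra hi
    have : i ∈ univ.filter fun i => σ.symm i ≠ i := by simpa using hi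
    simp [h'] at this
  obtain ⟨i₀, hi₀, hmax⟩ := exists_max_image _ id hne
  have hi₀' : σ.symm i₀ ≠ i₀ := by simpa using hi₀
  have hmax' : ∀ i, i₀ < i → σ.symm i = i := fun i hi => by
    by_contra h'
    exact absurd (hmax i (by simpa using h')) (not_le.2 hi)
  have hlt : σ.symm i₀ < i₀ := by
    refine lt_of_le_of_ne (not_lt.1 fun h' => ?_) hi₀'
    exact hi₀' (σ.symm.injective (hmax' _ h'))
  rw [hre]
  refine sum_single_lt (i₀ := i₀) (fun i => ?_) ?_ (fun _ _ => rfl)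
  · rcases lt_trichotomy i i₀ with hi | rfl | hi
    · exact Or.inr ⟨coordKey_inl_lt _ _ (hA hi), (coordKey_inl_lt _ _ (hA hi)).le⟩
    · refine Or.inr ⟨?_, le_rfl⟩
      have := Fin.rev_lt_rev.2 (show Fin.castLE h (σ.symm i) < Fin.castLE h i from hlt)
      rw [Fin.lt_def] at this
      simp only [coordKey, finProdFinEquiv_apply_val]
      omega
    · exact Or.inl (by simp only [hmax' i hi])
  · simpa using hi₀'

lemma wExp_lt {B : Fin s → Fin q} (hB : StrictMono B) (h : s ≤ n) {c : Fin s → Fin n}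
    (hc : Function.Injective c) (hne : c ≠ Fin.castLE h)
    {a b : (Fin m × Fin n) ⊕ (Fin n × Fin q) →₀ ℕ} (ha : ∀ p, a (.inr p) = b (.inr p)) :
    (wExp m c B + a) ≺[coordOrder n m q] (wExp m (Fin.castLE h) B + b) := by
  have hne' : (univ.filter fun i => c i ≠ Fin.castLE h i).Nonempty := by
    obtain ⟨i, hi⟩ := Function.ne_iff.1 hne
    exact ⟨i, by simpa using hi⟩
  obtain ⟨i₀, hi₀, hmin⟩ := exists_min_image _ id hne'
  have hi₀' : c i₀ ≠ Fin.castLE h i₀ := by simpa using hi₀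
  have hmin' : ∀ i, i < i₀ → c i = Fin.castLE h i := fun i hi => by
    by_contra h'
    exact absurd (hmin i (by simpa using h')) (not_le.2 hi)
  have hlt : Fin.castLE h i₀ < c i₀ := by
    refine lt_of_le_of_ne (not_lt.1 fun h' => ?_) hi₀'.symm
    have hlt' : (c i₀ : ℕ) < i₀ := h'
    have h2 := hmin' ⟨c i₀, hlt'.trans i₀.2⟩ hlt'
    have h3 : c ⟨c i₀, hlt'.trans i₀.2⟩ = c i₀ := by rw [h2]; rfl
    exact absurd (congrArg Fin.val (hc h3)) hlt'.ne
  refine sum_single_lt (i₀ := i₀) (fun i => ?_) ?_ ?_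
  · rcases lt_trichotomy i i₀ with hi | rfl | hi
    · exact Or.inl (by rw [hmin' i hi])
    · refine Or.inr ⟨?_, le_rfl⟩
      rw [Fin.lt_def] at hlt
      simp only [coordKey, finProdFinEquiv_apply_val]
      omega
    · exact Or.inr ⟨coordKey_inr_lt _ _ (hB hi), (coordKey_inr_lt _ _ (hB hi)).le⟩
  · simpa using hi₀'
  · rintro (p | p) hp
    · exact absurd hp (not_le.2 (coordKey_inr_lt_inl _ _))
    · exact ha p

lemma degree_uPoly {I : Fin n → Fin m} (hI : StrictMono I) :
    (coordOrder n m q).degree (uPoly K n m q I) = uExp q I id ∧ uPoly K n m q I ≠ 0 := by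
  have h : uPoly K n m q I = ∑ σ : Equiv.Perm (Fin n),
      monomial (uExp q (fun i => I (σ i)) id) ((σ.sign : ℤ) : K) := by
    unfold uPoly uExp
    rw [Matrix.det_apply']
    refine sum_congr rfl fun σ _ => ?_
    simp only [Matrix.of_apply, prod_X_eq_monomial, id]
    rw [← map_intCast (C : K →+* KX K n m q), C_mul_monomial, mul_one]
  rw [h]
  refine degree_sum_monomial (coordOrder n m q) (t₀ := 1)
    (e := fun σ : Equiv.Perm (Fin n) => uExp q (fun i => I (σ i)) id) (by simp) fun σ hσ => ?_
  simpa using uExp_lt hI le_rfl hσ 0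

lemma degree_xiPoly {J : Fin n → Fin q} (hJ : StrictMono J) :
    (coordOrder n m q).degree (xiPoly K n m q J) = wExp m id J ∧ xiPoly K n m q J ≠ 0 := by
  have h : xiPoly K n m q J = ∑ σ : Equiv.Perm (Fin n),
      monomial (wExp m σ J) ((σ.sign : ℤ) : K) := by
    unfold xiPoly wExp
    rw [Matrix.det_apply']
    refine sum_congr rfl fun σ _ => ?_
    simp only [Matrix.of_apply, prod_X_eq_monomial]
    rw [← map_intCast (C : K →+* KX K n m q), C_mul_monomial, mul_one]
  rw [h]
  refine degree_sum_monomial (coordOrder n m q) (t₀ := 1)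
    (e := fun σ : Equiv.Perm (Fin n) => wExp m σ J) (by simp) fun σ hσ => ?_
  simpa using wExp_lt (m := m) hJ le_rfl σ.injective (fun h' => hσ (Equiv.ext (congrFun h')))
    (a := 0) (b := 0) (fun _ => rfl)

lemma pPoly_eq_sum (x : PairIx m q) : pPoly K n m q x =
    ∑ t : (Fin x.s ↪ Fin n) × Equiv.Perm (Fin x.s),
      monomial (wExp m t.1 x.cols + uExp q (fun i => x.rows (t.2 i)) t.1)
        ((t.2.sign : ℤ) : K) := by
  classical
  have hexp : pPoly K n m q x = ∑ c : Fin x.s → Fin n, (∏ i, X (.inr (c i, x.cols i))) *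
      (Matrix.of fun i j => (X (.inl (x.rows i, c j)) : KX K n m q)).det := by
    unfold pPoly
    simp_rw [Matrix.det_apply', mul_sum]
    rw [sum_comm]
    refine sum_congr rfl fun σ _ => ?_
    simp only [Matrix.of_apply, Matrix.mul_apply, prod_univ_sum, Fintype.piFinset_univ, mul_sum]
    refine sum_congr rfl fun c _ => ?_
    rw [prod_mul_distrib]
    simp only [Ugen, Wgen, Matrix.of_apply]
    ring
  rw [hexp, Fintype.sum_prod_type]
  symm
  refine sum_of_injOn (fun c : Fin x.s ↪ Fin n => (c : Fin x.s → Fin n))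
    (fun _ _ _ _ h => DFunLike.coe_injective h) (fun _ _ => mem_coe.2 (mem_univ _)) ?_ ?_
  · intro c _ hc
    have hinj : ¬ Function.Injective c := fun h => hc ⟨⟨c, h⟩, by simp, rfl⟩
    obtain ⟨i, j, hij, hne⟩ := Function.not_injective_iff.1 hinj
    rw [Matrix.det_zero_of_column_eq hne fun k => by simp [hij], mul_zero]
  · intro c _
    rw [Matrix.det_apply', mul_sum]
    refine sum_congr rfl fun σ _ => ?_
    simp only [Matrix.of_apply, prod_X_eq_monomial]
    rw [← map_intCast (C : K →+* KX K n m q), C_mul_monomial, monomial_mul, mul_one, one_mul]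
    rfl

lemma degree_pPoly (x : PairIx m q) (h : x.s ≤ n) :
    (coordOrder n m q).degree (pPoly K n m q x)
      = wExp m (Fin.castLE h) x.cols + uExp q x.rows (Fin.castLE h) ∧ pPoly K n m q x ≠ 0 := by
  rw [pPoly_eq_sum]
  refine degree_sum_monomial (coordOrder n m q) (t₀ := (Fin.castLEEmb h, 1))
    (e := fun t : (Fin x.s ↪ Fin n) × Equiv.Perm (Fin x.s) =>
      wExp m t.1 x.cols + uExp q (fun i => x.rows (t.2 i)) t.1) (by simp) ?_
  rintro ⟨c, σ⟩ hne
  by_cases hc : c = Fin.castLEEmb h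
  · subst hc
    have hσ : σ ≠ 1 := by rintro rfl; exact hne rfl
    have := uExp_lt x.rmono h hσ (wExp m (Fin.castLE h) x.cols)
    simpa [add_comm] using this
  · refine wExp_lt x.cmono h c.injective (fun h' => hc (DFunLike.coe_injective h')) fun p => ?_
    simp [uExp, Finsupp.finsetSum_apply]

end Minors

section Ballot

variable {R n : ℕ}

/-- For `j < j'`, every initial segment of rows meets column `j'` at most as often as the segment
without its last row meets column `j`. -/
def IsBallot (a : Fin R → Fin n → ℕ) : Prop :=
  ∀ j j', j < j' → ∀ i, ∑ i' with i' ≤ i, a i' j' ≤ ∑ i' with i' < i, a i' j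

lemma IsBallot.exists_pos_of_pos {a : Fin R → Fin n → ℕ} (ha : IsBallot a) {j j' : Fin n}
    (hj : j < j') {i : Fin R} (hi : 0 < a i j') : ∃ i' < i, 0 < a i' j := by
  by_contra! h
  have h1 := ha j j' hj i
  rw [sum_eq_zero (s := univ.filter (· < i)) fun i' hi' =>
    Nat.le_zero.1 (h i' (mem_filter.1 hi').2)] at h1
  have h2 := sum_eq_zero_iff.1 (Nat.le_zero.1 h1) i (by simp)
  omega

lemma IsBallot.exists_length {a : Fin R → Fin n → ℕ} (ha : IsBallot a) :
    ∃ s ≤ n, ∀ j : Fin n, (j : ℕ) < s ↔ 0 < ∑ i, a i j := by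
  classical
  have hdown : ∀ j j' : Fin n, j ≤ j' → 0 < ∑ i, a i j' → 0 < ∑ i, a i j := by
    intro j j' hj h
    rcases hj.eq_or_lt with rfl | hj
    · exact h
    · obtain ⟨i, hi, hpos⟩ := exists_ne_zero_of_sum_ne_zero h.ne'
      obtain ⟨i', -, hi'⟩ := ha.exists_pos_of_pos hj (Nat.pos_of_ne_zero hpos)
      exact sum_pos' (fun _ _ => Nat.zero_le _) ⟨i', mem_univ _, hi'⟩
  have hex : ∃ s : ℕ, ∀ j : Fin n, s ≤ j → ¬ 0 < ∑ i, a i j :=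
    ⟨n, fun j hj => absurd j.2 (not_lt.2 hj)⟩
  refine ⟨Nat.find hex, Nat.find_min' hex fun j hj => absurd j.2 (not_lt.2 hj), fun j => ?_⟩
  constructor
  · intro hj
    have := Nat.find_min hex hj
    push Not at this
    obtain ⟨j', hj', hpos⟩ := this
    exact hdown j j' hj' hpos
  · intro hj
    by_contra h
    exact Nat.find_spec hex j (not_lt.1 h) hj

/-- The topmost boxes of the nonempty columns can be removed. -/
lemma IsBallot.exists_peel {a : Fin R → Fin n → ℕ} (ha : IsBallot a) {s : ℕ} (hs : s ≤ n)
    (hpos : ∀ j : Fin n, (j : ℕ) < s ↔ 0 < ∑ i, a i j) :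
    ∃ A : Fin s → Fin R, StrictMono A ∧ ∃ a' : Fin R → Fin n → ℕ, IsBallot a' ∧
      ∀ i j, a i j = a' i j + ∑ t, if A t = i ∧ Fin.castLE hs t = j then 1 else 0 := by
  classical
  have hmin : ∀ t : Fin s, ∃ i, 0 < a i (Fin.castLE hs t) ∧
      ∀ i' < i, a i' (Fin.castLE hs t) = 0 := by
    intro t
    obtain ⟨i, -, hi⟩ := exists_ne_zero_of_sum_ne_zero ((hpos (Fin.castLE hs t)).1 t.2).ne'
    obtain ⟨i₀, hi₀, hle⟩ := exists_min_image (univ.filter fun i => a i (Fin.castLE hs t) ≠ 0) id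
      ⟨i, by simpa using hi⟩
    refine ⟨i₀, Nat.pos_of_ne_zero (by simpa using hi₀), fun i' hi' => ?_⟩
    by_contra h
    exact absurd (hle i' (by simpa using h)) (not_le.2 hi')
  choose A hA hA0 using hmin
  have hmono : StrictMono A := by
    intro t t' ht
    obtain ⟨i', hi', h⟩ := ha.exists_pos_of_pos (j := Fin.castLE hs t) (j' := Fin.castLE hs t') ht
      (hA t')
    refine lt_of_le_of_lt (not_lt.1 fun hlt => ?_) hi'
    rw [hA0 t i' hlt] at h
    exact lt_irrefl _ h
  have hsum : ∀ i (j : Fin n), (∑ t, if A t = i ∧ Fin.castLE hs t = j then 1 else 0)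
      = if h : (j : ℕ) < s then (if A ⟨j, h⟩ = i then 1 else 0) else 0 := by
    intro i j
    split_ifs with h h'
    · rw [sum_eq_single ⟨j, h⟩, if_pos ⟨h', rfl⟩]
      · rintro t - ht
        exact if_neg fun h' => ht (by simpa [Fin.ext_iff] using h'.2)
      · simp
    · refine sum_eq_zero fun t _ => if_neg ?_
      rintro ⟨h1, rfl⟩
      exact h' h1
    · refine sum_eq_zero fun t _ => if_neg ?_
      rintro ⟨-, rfl⟩
      exact h t.2
  set e : Fin R → Fin n → ℕ := fun i j => ∑ t, if A t = i ∧ Fin.castLE hs t = j then 1 else 0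
    with he
  have hle : ∀ i j, e i j ≤ a i j := by
    intro i j
    simp only [he, hsum]
    split_ifs with h h'
    · rw [← h']
      exact hA ⟨j, h⟩
    · exact Nat.zero_le _
    · exact Nat.zero_le _
  have hdec : ∀ i j, a i j = (a i j - e i j) + e i j := fun i j => (Nat.sub_add_cancel (hle i j)).symm
  refine ⟨A, hmono, fun i j => a i j - e i j, fun j j' hj i => ?_, hdec⟩
  have hsplit : ∀ (P : Fin R → Prop) [DecidablePred P] (j : Fin n),
      ∑ i with P i, a i j = ∑ i with P i, (a i j - e i j) + ∑ i with P i, e i j := by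
    intro P _ j
    rw [← sum_add_distrib]
    exact sum_congr rfl fun i _ => hdec i j
  have h1 := ha j j' hj i
  by_cases hc : ∃ h : (j : ℕ) < s, A ⟨j, h⟩ < i
  · obtain ⟨h, hlt⟩ := hc
    have h2 : ∑ i' with i' < i, e i' j = 1 := by
      simp only [he, hsum, dif_pos h, sum_ite_eq, mem_filter, mem_univ, true_and, if_pos hlt]
    by_cases hc' : ∃ h' : (j' : ℕ) < s, A ⟨j', h'⟩ ≤ i
    · obtain ⟨h', hle'⟩ := hc'
      have h3 : ∑ i' with i' ≤ i, e i' j' = 1 := by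
        simp only [he, hsum, dif_pos h', sum_ite_eq, mem_filter, mem_univ, true_and, if_pos hle']
      rw [hsplit, hsplit, h2, h3] at h1
      exact Nat.add_le_add_iff_right.1 h1
    · have h3 : ∑ i' with i' ≤ i, a i' j' = 0 := by
        refine sum_eq_zero fun i' hi' => ?_
        by_cases h' : (j' : ℕ) < s
        · refine hA0 ⟨j', h'⟩ i' (lt_of_le_of_lt (mem_filter.1 hi').2 (not_le.1 fun hle' => ?_))
          exact hc' ⟨h', hle'⟩
        · exact sum_eq_zero_iff.1 (Nat.eq_zero_of_not_pos (fun h4 => h' ((hpos j').2 h4))) i'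
            (mem_univ _)
      rw [hsplit, Nat.add_eq_zero_iff] at h3
      rw [h3.1]
      exact Nat.zero_le _
  · have h2 : ∑ i' with i' < i, e i' j = 0 := by
      refine sum_eq_zero fun i' hi' => ?_
      simp only [he, hsum]
      split_ifs with h h'
      · exact absurd ⟨h, h' ▸ (mem_filter.1 hi').2⟩ hc
      · rfl
      · rfl
    rw [hsplit, hsplit _ j, h2] at h1
    exact (Nat.le_add_right _ _).trans h1

lemma sum_castLE_boole {s : ℕ} (hs : s ≤ n) (A : Fin s → Fin R) (j : Fin n) :
    ∑ i, ∑ t, (if A t = i ∧ Fin.castLE hs t = j then 1 else 0) = if (j : ℕ) < s then 1 else 0 := by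
  rw [sum_comm]
  simp_rw [ite_and, sum_ite_eq, if_pos (mem_univ _)]
  split_ifs with h
  · rw [sum_eq_single ⟨j, h⟩]
    · simp
    · rintro t - ht
      exact if_neg fun h' => ht (by simpa [Fin.ext_iff] using h')
    · simp
  · refine sum_eq_zero fun t _ => if_neg ?_
    rintro rfl
    exact h t.2

end Ballot

section HighestWeight

variable {K : Type} [Field K] {n m q : ℕ}

/-- The generators of the algebra of `SL_n(K)`-invariants. -/
def slGenerators (K : Type) [Field K] (n m q : ℕ) : Set (KX K n m q) :=
  {g : KX K n m q | ∃ x : PairIx m q, 0 < x.s ∧ x.s ≤ n ∧ g = pPoly K n m q x} ∪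
    {g | ∃ I : IncTup n m, g = uPoly K n m q I.f} ∪
    {g | ∃ J : IncTup n q, g = xiPoly K n m q J.f}

/-- The exponents that occur as degrees of `SL_n(K)`-invariants. -/
structure IsHighestWeight (M : (Fin m × Fin n) ⊕ (Fin n × Fin q) →₀ ℕ) : Prop where
  ballot_left : IsBallot fun i j => M (.inl (i, j))
  ballot_right : IsBallot fun l k => M (.inr (k, l))
  weight_eq : ∀ j j', ∑ i, M (.inl (i, j)) + ∑ l, M (.inr (j', l))
    = ∑ i, M (.inl (i, j')) + ∑ l, M (.inr (j, l))

lemma isHighestWeight_degree [Infinite K] {f : KX K n m q} (hf : IsSLInvariant f) (hf0 : f ≠ 0) :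
    IsHighestWeight ((coordOrder n m q).degree f) := by
  set M := (coordOrder n m q).degree f with hM
  have hwt : ∀ j j', ∑ i, M (.inl (i, j)) + ∑ l, M (.inr (j', l))
      = ∑ i, M (.inl (i, j')) + ∑ l, M (.inr (j, l)) := by
    intro j j'
    rcases eq_or_ne j j' with rfl | hj
    · rfl
    · have := weight_eq_of_isSLInvariant hf hj ((coordOrder n m q).degree_mem_support hf0)
      simpa [Fintype.sum_sum_type, addedCoord, changedCoord] using this
  refine ⟨fun j j' hj i => ?_, fun j j' hj l => ?_, hwt⟩
  · have h := ballot_of_isSLInvariant hf hf0 hj (.inl i)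
    rw [← hM] at h
    have h1 : ∀ l : Fin q, ¬ m + (l.rev : ℕ) ≤ i := fun l => by have := i.2; omega
    have h2 : ∀ l : Fin q, ¬ m + (l.rev : ℕ) < i := fun l => by have := i.2; omega
    rw [sum_filter, sum_filter, Fintype.sum_sum_type, Fintype.sum_sum_type] at h
    simpa only [sum_filter, vecRank, addedCoord, changedCoord, h1, h2,
      if_false, sum_const_zero, add_zero, Fin.val_fin_le, Fin.val_fin_lt] using h
  · have h := ballot_of_isSLInvariant hf hf0 hj (.inr l)
    rw [← hM] at h
    have h1 : ∀ i : Fin m, (i : ℕ) ≤ m + (l.rev : ℕ) := fun i => by have := i.2; omega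
    have h2 : ∀ i : Fin m, (i : ℕ) < m + (l.rev : ℕ) := fun i => by have := i.2; omega
    rw [sum_filter, sum_filter, Fintype.sum_sum_type, Fintype.sum_sum_type] at h
    simp only [vecRank, addedCoord, changedCoord, h1, h2,
      if_true, add_le_add_iff_left, add_lt_add_iff_left, Fin.val_fin_le, Fin.val_fin_lt,
      Fin.rev_le_rev, Fin.rev_lt_rev] at h
    simp only [← sum_filter] at h
    have h3 := sum_filter_add_sum_filter_not univ (fun l' => l' < l) fun l' => M (.inr (j, l'))
    have h4 := sum_filter_add_sum_filter_not univ (fun l' => l' ≤ l) fun l' => M (.inr (j', l'))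
    simp only [not_lt, not_le] at h3 h4
    have h5 := hwt j j'
    show ∑ l' with l' ≤ l, M (.inr (j', l')) ≤ ∑ l' with l' < l, M (.inr (j, l'))
    omega

lemma uExp_inl {s : ℕ} (A : Fin s → Fin m) (c : Fin s → Fin n) (i : Fin m) (j : Fin n) :
    uExp q A c (.inl (i, j)) = ∑ t, if A t = i ∧ c t = j then 1 else 0 := by
  simp [uExp, Finsupp.finsetSum_apply, Finsupp.single_apply]

lemma uExp_inr {s : ℕ} (A : Fin s → Fin m) (c : Fin s → Fin n) (p : Fin n × Fin q) :
    uExp q A c (.inr p) = 0 := by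
  simp [uExp, Finsupp.finsetSum_apply]

lemma wExp_inr {s : ℕ} (c : Fin s → Fin n) (B : Fin s → Fin q) (k : Fin n) (l : Fin q) :
    wExp m c B (.inr (k, l)) = ∑ t, if B t = l ∧ c t = k then 1 else 0 := by
  simp [wExp, Finsupp.finsetSum_apply, Finsupp.single_apply, and_comm]

lemma wExp_inl {s : ℕ} (c : Fin s → Fin n) (B : Fin s → Fin q) (p : Fin m × Fin n) :
    wExp m c B (.inl p) = 0 := by
  simp [wExp, Finsupp.finsetSum_apply]

lemma uExp_ne_zero {s : ℕ} (hs : 0 < s) (A : Fin s → Fin m) (c : Fin s → Fin n) :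
    uExp q A c ≠ 0 := by
  intro h
  have h1 := DFunLike.congr_fun h (.inl (A ⟨0, hs⟩, c ⟨0, hs⟩))
  rw [uExp_inl, Finsupp.coe_zero, Pi.zero_apply, sum_eq_zero_iff] at h1
  simpa using h1 ⟨0, hs⟩ (mem_univ _)

lemma wExp_ne_zero {s : ℕ} (hs : 0 < s) (c : Fin s → Fin n) (B : Fin s → Fin q) :
    wExp m c B ≠ 0 := by
  intro h
  have h1 := DFunLike.congr_fun h (.inr (c ⟨0, hs⟩, B ⟨0, hs⟩))
  rw [wExp_inr, Finsupp.coe_zero, Pi.zero_apply, sum_eq_zero_iff] at h1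
  simpa using h1 ⟨0, hs⟩ (mem_univ _)

/-- The exponent with given multiplicities in `U` and in the transpose of `W`. -/
noncomputable def expOf (a : Fin m → Fin n → ℕ) (b : Fin q → Fin n → ℕ) :
    (Fin m × Fin n) ⊕ (Fin n × Fin q) →₀ ℕ :=
  Finsupp.equivFunOnFinite.symm (Sum.elim (fun p => a p.1 p.2) fun p => b p.2 p.1)

/-- The degree of a generator can be removed from a nonzero highest weight. -/
lemma IsHighestWeight.exists_generator (hn : 0 < n)
    {M : (Fin m × Fin n) ⊕ (Fin n × Fin q) →₀ ℕ} (hM : IsHighestWeight M) (hM0 : M ≠ 0) :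
    ∃ g ∈ slGenerators K n m q, g ≠ 0 ∧ (coordOrder n m q).degree g ≠ 0 ∧
      ∃ M', IsHighestWeight M' ∧ M = M' + (coordOrder n m q).degree g := by
  obtain ⟨hU, hW, hwt⟩ := hM
  have hdec : ∀ {R s : ℕ} {a a' : Fin R → Fin n → ℕ} {hs : s ≤ n} {A : Fin s → Fin R},
      (∀ i j, a i j = a' i j + ∑ t, if A t = i ∧ Fin.castLE hs t = j then 1 else 0) →
      ∀ j : Fin n, ∑ i, a i j = ∑ i, a' i j + if (j : ℕ) < s then 1 else 0 := by
    intro R s a a' hs A h j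
    rw [← sum_castLE_boole hs A, ← sum_add_distrib]
    exact sum_congr rfl fun i _ => h i j
  rcases lt_trichotomy (∑ l, M (.inr (⟨0, hn⟩, l))) (∑ i, M (.inl (i, ⟨0, hn⟩))) with h0 | h0 | h0
  · obtain ⟨A, hA, a', ha', hdA⟩ := hU.exists_peel le_rfl fun j =>
      iff_of_true j.2 (show 0 < ∑ i, M (.inl (i, j)) by have := hwt j ⟨0, hn⟩; omega)
    obtain ⟨hd, hg0⟩ := degree_uPoly (K := K) (q := q) hA
    refine ⟨uPoly K n m q A, Or.inl (Or.inr ⟨⟨A, hA⟩, rfl⟩), hg0, hd ▸ uExp_ne_zero hn _ _,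
      expOf a' fun l k => M (.inr (k, l)), ⟨ha', hW, fun j j' => ?_⟩, ?_⟩
    · have h1 := hwt j j'
      have h2 := hdec hdA j
      have h3 := hdec hdA j'
      simp only [j.2, j'.2, if_true] at h2 h3
      simp only [expOf, Finsupp.equivFunOnFinite_symm_apply_apply, Sum.elim_inl, Sum.elim_inr]
      omega
    · rw [hd]
      ext (⟨i, j⟩ | ⟨k, l⟩)
      · rw [Finsupp.add_apply, uExp_inl]
        exact hdA i j
      · rw [Finsupp.add_apply, uExp_inr]
        rfl
  · have heq : ∀ j, ∑ l, M (.inr (j, l)) = ∑ i, M (.inl (i, j)) := fun j => by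
      have := hwt j ⟨0, hn⟩
      omega
    obtain ⟨s, hs, hpos⟩ := hU.exists_length
    have hs0 : 0 < s := by
      by_contra h
      refine hM0 (Finsupp.ext ?_)
      have hz : ∀ j, ∑ i, M (.inl (i, j)) = 0 := fun j =>
        Nat.eq_zero_of_not_pos fun hp => h ((Nat.zero_le _).trans_lt ((hpos j).2 hp))
      rintro (⟨i, j⟩ | ⟨k, l⟩)
      · exact sum_eq_zero_iff.1 (hz j) i (mem_univ _)
      · exact sum_eq_zero_iff.1 ((heq k).trans (hz k)) l (mem_univ _)
    obtain ⟨A, hA, a', ha', hdA⟩ := hU.exists_peel hs hpos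
    obtain ⟨B, hB, b', hb', hdB⟩ := hW.exists_peel hs fun j => by rw [hpos j, heq j]
    obtain ⟨hd, hg0⟩ := degree_pPoly (K := K) (n := n) ⟨s, A, B, hA, hB⟩ hs
    refine ⟨pPoly K n m q ⟨s, A, B, hA, hB⟩, Or.inl (Or.inl ⟨_, hs0, hs, rfl⟩), hg0, ?_,
      expOf a' b', ⟨ha', hb', fun j j' => ?_⟩, ?_⟩
    · rw [hd]
      exact fun h => wExp_ne_zero hs0 _ _ (add_eq_zero.1 h).1
    · have h1 := hwt j j'
      have h2 := hdec hdA j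
      have h3 := hdec hdA j'
      have h4 := hdec hdB j
      have h5 := hdec hdB j'
      simp only [expOf, Finsupp.equivFunOnFinite_symm_apply_apply, Sum.elim_inl, Sum.elim_inr]
      omega
    · rw [hd]
      ext (⟨i, j⟩ | ⟨k, l⟩)
      · rw [Finsupp.add_apply, Finsupp.add_apply, uExp_inl, wExp_inl, zero_add]
        exact hdA i j
      · rw [Finsupp.add_apply, Finsupp.add_apply, uExp_inr, wExp_inr, add_zero]
        exact hdB l k
  · obtain ⟨B, hB, b', hb', hdB⟩ := hW.exists_peel le_rfl fun j =>
      iff_of_true j.2 (show 0 < ∑ l, M (.inr (j, l)) by have := hwt j ⟨0, hn⟩; omega)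
    obtain ⟨hd, hg0⟩ := degree_xiPoly (K := K) (m := m) hB
    refine ⟨xiPoly K n m q B, Or.inr ⟨⟨B, hB⟩, rfl⟩, hg0, hd ▸ wExp_ne_zero hn _ _,
      expOf (fun i j => M (.inl (i, j))) b', ⟨hU, hb', fun j j' => ?_⟩, ?_⟩
    · have h1 := hwt j j'
      have h2 := hdec hdB j
      have h3 := hdec hdB j'
      simp only [j.2, j'.2, if_true] at h2 h3
      simp only [expOf, Finsupp.equivFunOnFinite_symm_apply_apply, Sum.elim_inl, Sum.elim_inr]
      omega
    · rw [hd]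
      ext (⟨i, j⟩ | ⟨k, l⟩)
      · rw [Finsupp.add_apply, wExp_inl]
        rfl
      · rw [Finsupp.add_apply, wExp_inr]
        exact hdB l k

lemma IsHighestWeight.exists_mem_adjoin (hn : 0 < n)
    {M : (Fin m × Fin n) ⊕ (Fin n × Fin q) →₀ ℕ} (hM : IsHighestWeight M) :
    ∃ r ∈ Algebra.adjoin K (slGenerators K n m q), r ≠ 0 ∧ (coordOrder n m q).degree r = M := by
  induction M using WellFoundedLT.induction with
  | ind M ih =>
    by_cases hM0 : M = 0
    · exact ⟨1, one_mem _, one_ne_zero, by rw [hM0, degree_one]⟩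
    obtain ⟨g, hg, hg0, hd0, M', hM', rfl⟩ := hM.exists_generator (K := K) hn hM0
    obtain ⟨r, hr, hr0, hrd⟩ := ih M' (lt_add_of_pos_right _ (pos_iff_ne_zero.2 hd0)) hM'
    exact ⟨r * g, mul_mem hr (Algebra.subset_adjoin hg), mul_ne_zero hr0 hg0,
      by rw [degree_mul hr0 hg0, hrd]⟩

end HighestWeight

section FirstFundamentalTheorem

variable {K : Type} [Field K] {n m q : ℕ}

lemma map_Ugen (U : Matrix (Fin m) (Fin n) K) (W : Matrix (Fin n) (Fin q) K) :
    (Ugen K n m q).map (evalX K n m q U W) = U := by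
  ext i j
  simp [Ugen, evalX]

lemma map_Wgen (U : Matrix (Fin m) (Fin n) K) (W : Matrix (Fin n) (Fin q) K) :
    (Wgen K n m q).map (evalX K n m q U W) = W := by
  ext k l
  simp [Wgen, evalX]

lemma evalX_pPoly (U : Matrix (Fin m) (Fin n) K) (W : Matrix (Fin n) (Fin q) K) (x : PairIx m q) :
    evalX K n m q U W (pPoly K n m q x) = ((U * W).submatrix x.rows x.cols).det := by
  have h : (Ugen K n m q * Wgen K n m q).map (evalX K n m q U W) = U * W := by
    rw [Matrix.map_mul, map_Ugen, map_Wgen]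
  rw [pPoly, RingHom.map_det, ← h]
  rfl

lemma evalX_uPoly (U : Matrix (Fin m) (Fin n) K) (W : Matrix (Fin n) (Fin q) K)
    (I : Fin n → Fin m) : evalX K n m q U W (uPoly K n m q I) = (U.submatrix I id).det := by
  rw [uPoly, RingHom.map_det]
  conv_rhs => rw [← map_Ugen U W]
  rfl

lemma evalX_xiPoly (U : Matrix (Fin m) (Fin n) K) (W : Matrix (Fin n) (Fin q) K)
    (J : Fin n → Fin q) : evalX K n m q U W (xiPoly K n m q J) = (W.submatrix id J).det := by
  rw [xiPoly, RingHom.map_det]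
  conv_rhs => rw [← map_Wgen U W]
  rfl

lemma isSLInvariant_of_mem_slGenerators {g : KX K n m q} (hg : g ∈ slGenerators K n m q) :
    IsSLInvariant g := by
  intro A U W
  rcases hg with (⟨x, -, -, rfl⟩ | ⟨I, rfl⟩) | ⟨J, rfl⟩
  · rw [evalX_pPoly, evalX_pPoly, Matrix.mul_assoc, ← Matrix.mul_assoc _ _ W,
      ← Matrix.SpecialLinearGroup.coe_mul, mul_inv_cancel, Matrix.SpecialLinearGroup.coe_one,
      Matrix.one_mul]
  · rw [evalX_uPoly, evalX_uPoly, Matrix.submatrix_mul _ _ I.f id id Function.bijective_id,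
      Matrix.submatrix_id_id, Matrix.det_mul, A.det_coe, mul_one]
  · rw [evalX_xiPoly, evalX_xiPoly, Matrix.submatrix_mul _ _ id id J.f Function.bijective_id,
      Matrix.submatrix_id_id, Matrix.det_mul, (A⁻¹).det_coe, one_mul]

lemma isSLInvariant_of_mem_adjoin {g : KX K n m q}
    (hg : g ∈ Algebra.adjoin K (slGenerators K n m q)) : IsSLInvariant g := by
  induction hg using Algebra.adjoin_induction with
  | mem g hg => exact isSLInvariant_of_mem_slGenerators hg
  | algebraMap c => exact fun A U W => by simp [evalX, algebraMap_eq]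
  | add g h _ _ hg hh => exact fun A U W => by rw [map_add, map_add, hg A U W, hh A U W]
  | mul g h _ _ hg hh => exact fun A U W => by rw [map_mul, map_mul, hg A U W, hh A U W]

lemma mem_adjoin_of_isSLInvariant [Infinite K] (hn : 0 < n) {f : KX K n m q}
    (hf : IsSLInvariant f) : f ∈ Algebra.adjoin K (slGenerators K n m q) := by
  set ord := coordOrder n m q with hord
  induction hd : ord.toSyn (ord.degree f) using ord.wellFoundedLT_syn.wf.induction generalizing f with
  | h d ih =>
    subst hd
    by_cases hf0 : f = 0
    · rw [hf0]
      exact zero_mem _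
    obtain ⟨r, hr, hr0, hrd⟩ :=
      (isHighestWeight_degree hf hf0).exists_mem_adjoin (K := K) hn
    set c := ord.leadingCoeff f / ord.leadingCoeff r with hc
    have hcr : c • r ∈ Algebra.adjoin K (slGenerators K n m q) := Subalgebra.smul_mem _ hr c
    have hg : IsSLInvariant (f - c • r) := fun A U W => by
      rw [map_sub, map_sub, hf A U W, isSLInvariant_of_mem_adjoin hcr A U W]
    suffices h : f - c • r ∈ Algebra.adjoin K (slGenerators K n m q) by
      simpa using add_mem h hcr
    by_cases hg0 : f - c • r = 0
    · rw [hg0]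
      exact zero_mem _
    refine ih _ (lt_of_le_of_ne ?_ fun h => ?_) hg rfl
    · refine ord.degree_sub_le.trans (sup_le le_rfl ?_)
      refine ord.degree_smul_le.trans ?_
      rw [hrd]
    · have h1 : ord.degree (f - c • r) = ord.degree f := ord.toSyn.injective h
      have h2 := ord.coeff_degree_ne_zero_iff.2 hg0
      refine h2 ?_
      rw [h1, coeff_sub, coeff_smul]
      nth_rewrite 2 [← hrd]
      change ord.leadingCoeff f - c * ord.leadingCoeff r = 0
      rw [hc, div_mul_cancel₀ _ (ord.leadingCoeff_ne_zero_iff.2 hr0), sub_self]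

end FirstFundamentalTheorem

end SMB

open SMB in
/-- **First fundamental theorem for `SL_n(K)`-invariants.**
Every `SL_n(K)`-invariant polynomial on `X = M_{m,n}(K) × M_{n,q}(K)` lies in the
`K`-subalgebra of `K[X]` generated by the minors `p(A,B)` (`(A,B) ∈ H_p`), the maximal
minors `u(I)` (`I ∈ I(n,m)`) and the maximal minors `ξ(J)` (`J ∈ I(n,q)`). -/
theorem sl_first_fundamental_theorem (K : Type) [Field K] [IsAlgClosed K]
    (n m q : ℕ) (hn : 0 < n) (hm : n < m) (hq : n < q)
    (f : KX K n m q) (hf : IsSLInvariant f) :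
    f ∈ Algebra.adjoin K
      ({g : KX K n m q | ∃ x : PairIx m q, 0 < x.s ∧ x.s ≤ n ∧ g = pPoly K n m q x} ∪
       {g | ∃ I : IncTup n m, g = uPoly K n m q I.f} ∪
       {g | ∃ J : IncTup n q, g = xiPoly K n m q J.f}) := by
  have : Infinite K := IsAlgClosed.instInfinite
  exact mem_adjoin_of_isSLInvariant hn hf
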